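/- Let F be a finite field of odd cardinality q, let V be a 3-dimensional vector space over F, and let Q be a quadratic form on V whose polar form B(u, w) = Q(u + w) − Q(u) − Q(w) is nondegenerate on V. Then the number of 2-dimensional subspaces U ≤ V which are nondegenerate (the restriction of B to U is nondegenerate) and anisotropic (Q(u) ≠ 0 for every nonzero u ∈ U) — the 2-spaces of minus type — is exactly q(q − 1)/2. -/

import Mathlib

theorem two_mul_ncard_not_isSquare {F : Type*} [Field F] [Fintype F] (hF : ringChar F ≠ 2) :
    2 * {s : F | ¬ IsSquare s}.ncard + 1 = Fintype.card F := by
  classical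
  have hsum := quadraticChar_sum_zero hF
  have hterm : ∀ s : F, 1 - quadraticChar F s =
      (if s = 0 then 1 else 0) + 2 * (if ¬ IsSquare s then 1 else 0) := by
    intro s
    rcases eq_or_ne s 0 with rfl | hs
    · simp
    · by_cases hsq : IsSquare s
      · simp [(quadraticChar_one_iff_isSquare hs).2 hsq, hs, hsq]
      · simp [quadraticChar_neg_one_iff_not_isSquare.2 hsq, hs, hsq]
  have key := Finset.sum_congr (rfl : (Finset.univ : Finset F) = Finset.univ) fun s _ => hterm s
  rw [Finset.sum_sub_distrib, hsum, Finset.sum_add_distrib, ← Finset.mul_sum, Finset.sum_boole,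
    Finset.sum_boole] at key
  have hn : {s : F | ¬ IsSquare s}.ncard = (Finset.univ.filter fun s : F => ¬ IsSquare s).card := by
    rw [← Set.ncard_coe_finset]; simp
  rw [hn]
  have h1 : (Finset.univ.filter fun s : F => s = 0).card = 1 :=
    Finset.card_eq_one.2 ⟨0, by ext; simp⟩
  rw [h1, Finset.sum_const, Finset.card_univ, nsmul_one, Nat.cast_one, sub_zero] at key
  zify
  linarith

theorem exists_isotropic_of_finrank_eq_three {F V : Type*} [Field F] [Fintype F]
    [AddCommGroup V] [Module F V] [FiniteDimensional F V] (hF : ringChar F ≠ 2)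
    (hV : Module.finrank F V = 3) (Q : QuadraticForm F V)
    (hB : ∀ u : V, (∀ w : V, QuadraticMap.polar Q u w = 0) → u = 0) :
    ∃ e : V, e ≠ 0 ∧ Q e = 0 := by
  have h2 : (2 : F) ≠ 0 := Ring.two_ne_zero hF
  have : Invertible (2 : F) := invertibleOfNonzero h2
  have hsep : (QuadraticMap.associated (R := F) Q).SeparatingLeft := by
    intro u hu
    refine hB u fun w => ?_
    have := hu w
    rw [QuadraticMap.associated_apply] at this
    simpa [QuadraticMap.polar, h2] using this
  have h := QuadraticForm.equivalent_weightedSumSquares_units_of_nondegenerate' Q hsep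
  rw [hV] at h
  obtain ⟨w, ⟨φ⟩⟩ := h
  obtain ⟨x, y, hxy⟩ := FiniteField.exists_root_sum_quadratic
    (f := Polynomial.C (w 0 : F) * Polynomial.X ^ 2 + Polynomial.C (w 2 : F))
    (g := Polynomial.C (w 1 : F) * Polynomial.X ^ 2)
    (by compute_degree!) (by compute_degree!) (FiniteField.odd_card_of_char_ne_two hF)
  refine ⟨φ.symm ![x, y, 1], fun h0 => ?_, ?_⟩
  · have := (φ.symm.toLinearEquiv.map_eq_zero_iff).1 h0
    simpa using congrFun this 2
  · rw [φ.symm.map_app]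
    simp [QuadraticMap.weightedSumSquares_apply, Fin.sum_univ_three, Units.smul_def] at hxy ⊢
    linear_combination hxy

/-- Coordinates `x, y, z` in which `Q = x y + d z²`. -/
theorem exists_hyperbolic_coordinates {F V : Type*} [Field F] [Fintype F]
    [AddCommGroup V] [Module F V] [FiniteDimensional F V] (hF : ringChar F ≠ 2)
    (hV : Module.finrank F V = 3) (Q : QuadraticForm F V)
    (hB : ∀ u : V, (∀ w : V, QuadraticMap.polar Q u w = 0) → u = 0) :
    ∃ (d : F) (φ : (F × F × F) ≃ₗ[F] V), d ≠ 0 ∧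
      ∀ x y z, Q (φ (x, y, z)) = x * y + d * z ^ 2 := by
  have h2 : (2 : F) ≠ 0 := Ring.two_ne_zero hF
  obtain ⟨e, he0, he⟩ := exists_isotropic_of_finrank_eq_three hF hV Q hB
  obtain ⟨w, hw⟩ : ∃ w, QuadraticMap.polar Q e w ≠ 0 := by
    by_contra! h
    exact he0 (hB e h)
  obtain ⟨f, hf, hef⟩ : ∃ f, Q f = 0 ∧ QuadraticMap.polar Q e f = 1 := by
    set c := QuadraticMap.polar Q e w with hc
    refine ⟨c⁻¹ • w - (c⁻¹ ^ 2 * Q w) • e, ?_, ?_⟩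
    · rw [sub_eq_add_neg, QuadraticMap.map_add Q, ← neg_smul, QuadraticMap.map_smul,
        QuadraticMap.map_smul, QuadraticMap.polar_smul_left, QuadraticMap.polar_smul_right,
        QuadraticMap.polar_comm, ← hc, he]
      simp only [smul_eq_mul]
      field_simp
      ring
    · rw [QuadraticMap.polar_sub_right, QuadraticMap.polar_smul_right,
        QuadraticMap.polar_smul_right, QuadraticMap.polar_self, ← hc, he]
      simp [hw]
  obtain ⟨g, hg0, heg, hfg⟩ : ∃ g, g ≠ 0 ∧ QuadraticMap.polar Q e g = 0 ∧
      QuadraticMap.polar Q f g = 0 := by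
    let L : V →ₗ[F] F × F := (Q.polarBilin e).prod (Q.polarBilin f)
    obtain ⟨g, hg, hg0⟩ := Submodule.exists_mem_ne_zero_of_ne_bot
      (LinearMap.ker_ne_bot_of_finrank_lt (f := L) (by simp [hV]))
    have := LinearMap.mem_ker.1 hg
    simp [L] at this
    exact ⟨g, hg0, this.1, this.2⟩
  have hform : ∀ x y z : F, Q (x • e + y • f + z • g) = x * y + Q g * z ^ 2 := by
    intro x y z
    simp only [QuadraticMap.map_add Q, QuadraticMap.map_smul, QuadraticMap.polar_add_left,
      QuadraticMap.polar_smul_left, QuadraticMap.polar_smul_right, he, hf, hef, heg, hfg,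
      smul_eq_mul]
    ring
  let T : F × F × F →ₗ[F] V :=
    (LinearMap.toSpanSingleton F V e).coprod
      ((LinearMap.toSpanSingleton F V f).coprod (LinearMap.toSpanSingleton F V g))
  have hT : ∀ x y z, T (x, y, z) = x • e + y • f + z • g := by
    intro x y z
    simp [T, add_assoc]
  have hinj : LinearMap.ker T = ⊥ := by
    rw [LinearMap.ker_eq_bot']
    rintro ⟨x, y, z⟩ h
    rw [hT] at h
    have hy : y = 0 := by
      have := congrArg (QuadraticMap.polar Q e) h
      simpa [QuadraticMap.polar_add_right, QuadraticMap.polar_smul_right, he, hef, heg] using this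
    have hx : x = 0 := by
      have := congrArg (QuadraticMap.polar Q f) h
      simpa [QuadraticMap.polar_add_right, QuadraticMap.polar_smul_right, hf, hfg,
        QuadraticMap.polar_comm Q f e, hef] using this
    subst hx hy
    simpa [hg0] using h
  have hdim : Module.finrank F (F × F × F) = Module.finrank F V := by simp [hV]
  refine ⟨Q g, T.linearEquivOfInjective (LinearMap.ker_eq_bot.1 hinj) hdim, fun hQg => ?_, ?_⟩
  · refine hg0 (hB g fun v => ?_)
    obtain ⟨⟨x, y, z⟩, rfl⟩ :=
      (T.linearEquivOfInjective (LinearMap.ker_eq_bot.1 hinj) hdim).surjective v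
    rw [LinearMap.linearEquivOfInjective_apply, hT]
    simp [hQg, QuadraticMap.polar_comm Q g, heg, hfg]
  · intro x y z
    rw [LinearMap.linearEquivOfInjective_apply, hT, hform]

/-- The plane with equation `y = a x + b z` in the coordinates `φ`. -/
def graphPlane {F V : Type*} [Field F] [AddCommGroup V] [Module F V]
    (φ : (F × F × F) ≃ₗ[F] V) (a b : F) : Submodule F V :=
  LinearMap.ker (((LinearMap.fst F F F ∘ₗ LinearMap.snd F F (F × F)) - a • LinearMap.fst F F (F × F)
    - b • (LinearMap.snd F F F ∘ₗ LinearMap.snd F F (F × F))) ∘ₗ φ.symm.toLinearMap)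

section graphPlane

variable {F V : Type*} [Field F] [AddCommGroup V] [Module F V] (φ : (F × F × F) ≃ₗ[F] V)

theorem mem_graphPlane {a b x y z : F} :
    φ (x, y, z) ∈ graphPlane φ a b ↔ y = a * x + b * z := by
  simp only [graphPlane, LinearMap.mem_ker, LinearMap.comp_apply, LinearEquiv.coe_coe,
    LinearEquiv.symm_apply_apply, LinearMap.sub_apply, LinearMap.smul_apply, LinearMap.fst_apply,
    LinearMap.snd_apply, smul_eq_mul]
  rw [sub_sub, sub_eq_zero]

theorem graphPlane_injective :
    Function.Injective fun p : F × F => graphPlane φ p.1 p.2 := by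
  rintro ⟨a, b⟩ ⟨a', b'⟩ (h : graphPlane φ a b = graphPlane φ a' b')
  have h1 : φ (1, a, 0) ∈ graphPlane φ a' b' := h ▸ (mem_graphPlane φ).2 (by ring)
  have h2 : φ (0, b, 1) ∈ graphPlane φ a' b' := h ▸ (mem_graphPlane φ).2 (by ring)
  rw [mem_graphPlane] at h1 h2
  ext
  · simpa using h1
  · simpa using h2

theorem finrank_graphPlane (a b : F) : Module.finrank F (graphPlane φ a b) = 2 := by
  have : FiniteDimensional F V := Module.Finite.equiv φ
  have h := Module.Dual.finrank_ker_add_one_of_ne_zero (K := F)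
    (f := ((LinearMap.fst F F F ∘ₗ LinearMap.snd F F (F × F)) - a • LinearMap.fst F F (F × F)
    - b • (LinearMap.snd F F F ∘ₗ LinearMap.snd F F (F × F))) ∘ₗ φ.symm.toLinearMap) (by
      intro h0
      simpa using LinearMap.congr_fun h0 (φ (0, 1, 0)))
  rw [← φ.finrank_eq] at h
  simp only [Module.finrank_prod, Module.finrank_self] at h
  exact Nat.succ_injective h

theorem exists_eq_graphPlane {U : Submodule F V} (hU : Module.finrank F U = 2)
    (hf : φ (0, 1, 0) ∉ U) : ∃ a b, U = graphPlane φ a b := by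
  have : FiniteDimensional F V := Module.Finite.equiv φ
  obtain ⟨l, hlf, hl⟩ := Submodule.exists_le_ker_of_notMem hf
  set β := l (φ (0, 1, 0)) with hβ
  refine ⟨-(β⁻¹ * l (φ (1, 0, 0))), -(β⁻¹ * l (φ (0, 0, 1))),
    Submodule.eq_of_le_of_finrank_eq (fun u hu => ?_) (by rw [hU, finrank_graphPlane])⟩
  obtain ⟨⟨x, y, z⟩, rfl⟩ := φ.surjective u
  have h0 : l (φ (x, y, z)) = 0 := hl hu
  have hdec : ((x, y, z) : F × F × F) = x • (1, 0, 0) + y • (0, 1, 0) + z • (0, 0, 1) := by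
    simp
  rw [hdec] at h0
  simp only [map_add, map_smul, smul_eq_mul, ← hβ] at h0
  rw [mem_graphPlane]
  field_simp
  linear_combination h0

theorem anisotropic_graphPlane_iff (h2 : (2 : F) ≠ 0) {Q : QuadraticForm F V} {d : F} (hd : d ≠ 0)
    (hQ : ∀ x y z, Q (φ (x, y, z)) = x * y + d * z ^ 2) (a b : F) :
    (∀ u ∈ graphPlane φ a b, u ≠ 0 → Q u ≠ 0) ↔ ¬ IsSquare (discrim d b a) := by
  have : NeZero (2 : F) := ⟨h2⟩
  constructor
  · rintro h hsq
    obtain ⟨t, ht⟩ := exists_quadratic_eq_zero hd hsq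
    refine h (φ (1, a * 1 + b * t, t)) ((mem_graphPlane φ).2 rfl) (by simp) ?_
    rw [hQ]
    linear_combination ht
  · intro h u hu hu0 hQu
    obtain ⟨⟨x, y, z⟩, rfl⟩ := φ.surjective u
    rw [mem_graphPlane] at hu
    rw [hQ, hu] at hQu
    rcases eq_or_ne x 0 with rfl | hx
    · have hz : z = 0 := by simpa [hd] using hQu
      subst hz
      simp [hu] at hu0
    · refine h ⟨2 * d * (z / x) + b, ?_⟩
      rw [← sq]
      refine discrim_eq_sq_of_quadratic_eq_zero ?_
      field_simp
      linear_combination hQu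

end graphPlane

theorem ncard_not_isSquare_discrim {F : Type*} [Field F] [Fintype F] (h2 : (2 : F) ≠ 0) {d : F}
    (hd : d ≠ 0) :
    {p : F × F | ¬ IsSquare (discrim d p.2 p.1)}.ncard =
      Fintype.card F * {s : F | ¬ IsSquare s}.ncard := by
  have h4 : (4 : F) ≠ 0 := by
    have : (4 : F) = 2 * 2 := by norm_num
    rw [this]
    exact mul_ne_zero h2 h2
  rw [← Nat.card_eq_fintype_card, ← Set.ncard_univ, ← Set.ncard_prod]
  refine Set.ncard_congr (fun p _ => (p.2, discrim d p.2 p.1)) (fun p hp => ⟨trivial, hp⟩) ?_ ?_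
  · rintro ⟨a, b⟩ ⟨a', b'⟩ - - h
    obtain ⟨rfl, h⟩ := Prod.mk.inj h
    simp only [discrim] at h
    have : a = a' := mul_left_cancel₀ (mul_ne_zero h4 hd) (by linear_combination -h)
    rw [this]
  · rintro ⟨b, s⟩ ⟨-, hs⟩
    have h : discrim d b ((b ^ 2 - s) / (4 * d)) = s := by
      simp only [discrim]
      field_simp
      ring
    exact ⟨((b ^ 2 - s) / (4 * d), b), by simpa [h] using hs, by simp [h]⟩


theorem card_minus_type_two_spaces {F V : Type*} [Field F] [Fintype F]
    [AddCommGroup V] [Module F V] [FiniteDimensional F V]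
    (q : ℕ) (hq : q = Fintype.card F) (hodd : Odd q)
    (hV : Module.finrank F V = 3)
    (Q : QuadraticForm F V)
    (hB : ∀ u : V, (∀ w : V, QuadraticMap.polar Q u w = 0) → u = 0) :
    2 * {U : Submodule F V | Module.finrank F U = 2 ∧
       (∀ u ∈ U, (∀ w ∈ U, QuadraticMap.polar Q u w = 0) → u = 0) ∧
       (∀ u ∈ U, u ≠ 0 → Q u ≠ 0)}.ncard = q * (q - 1) := by
  subst hq
  have hF : ringChar F ≠ 2 := fun h =>
    Nat.not_even_iff_odd.2 hodd (Nat.even_iff.2 (FiniteField.even_card_iff_char_two.1 h))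
  have h2 : (2 : F) ≠ 0 := Ring.two_ne_zero hF
  obtain ⟨d, φ, hd, hQ⟩ := exists_hyperbolic_coordinates hF hV Q hB
  have hset : {U : Submodule F V | Module.finrank F U = 2 ∧
       (∀ u ∈ U, (∀ w ∈ U, QuadraticMap.polar Q u w = 0) → u = 0) ∧
       (∀ u ∈ U, u ≠ 0 → Q u ≠ 0)} =
      Set.image (fun p : F × F => graphPlane φ p.1 p.2) {p | ¬ IsSquare (discrim d p.2 p.1)} := by
    ext U
    constructor
    · rintro ⟨hU, -, hani⟩
      obtain ⟨a, b, rfl⟩ := exists_eq_graphPlane φ hU fun hf =>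
        hani _ hf (by simp) (by simp [hQ])
      exact ⟨(a, b), (anisotropic_graphPlane_iff φ h2 hd hQ a b).1 hani, rfl⟩
    · rintro ⟨⟨a, b⟩, hab, rfl⟩
      have hani := (anisotropic_graphPlane_iff φ h2 hd hQ a b).2 hab
      refine ⟨finrank_graphPlane φ a b, fun u hu hpolar => ?_, hani⟩
      by_contra hu0
      have h := hpolar u hu
      rw [QuadraticMap.polar_self, nsmul_eq_mul] at h
      exact mul_ne_zero (by exact_mod_cast h2) (hani u hu hu0) h
  have hcard := two_mul_ncard_not_isSquare hF
  rw [hset, Set.ncard_image_of_injective _ (graphPlane_injective φ),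
    ncard_not_isSquare_discrim h2 hd, mul_left_comm, ← hcard, Nat.add_sub_cancel]
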